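/- arXiv:2411.05703 — 6 statements merged into one kernel-verified Lean document; each statement's English description precedes it below -/
import Mathlib

section
/- Let a : Fin d₁ → Fin d₂ → Fin d₃ → ℂ be the coefficient tensor of a tripartite state admitting a Schmidt decomposition a i j k = ∑_{ℓ=1}^{r} λ_ℓ · (u_ℓ i) · (v_ℓ j) · (w_ℓ k) with λ_ℓ > 0 and (u_ℓ), (v_ℓ), (w_ℓ) orthonormal families. Then the reduced density matrix of the joint subsystem AB satisfies (ρ_{AB}) (i,j) (l,m) = ∑_{ℓ=1}^{r} λ_ℓ² · (u_ℓ i)(v_ℓ j) · conj((u_ℓ l)(v_ℓ m)). In particular, ρ_A, ρ_B, ρ_C, ρ_{AB}, ρ_{AC}, ρ_{BC} all have the same nonzero eigenvalues λ_1², …, λ_r². -/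
open scoped BigOperators

/-- Up to zero, the products `A * B` and `B * A` of rectangular matrices have the same spectrum. -/
theorem Matrix.spectrum_mul_comm_diff_zero {K m n : Type*} [Field K] [Fintype m] [DecidableEq m]
    [Fintype n] [DecidableEq n] (A : Matrix m n K) (B : Matrix n m K) :
    spectrum K (A * B) \ {0} = spectrum K (B * A) \ {0} := by
  ext x
  simp only [Set.mem_sdiff, Set.mem_singleton_iff, Matrix.mem_spectrum_iff_isRoot_charpoly]
  refine and_congr_left fun hx => ?_
  have h := congrArg (Polynomial.eval x) (Matrix.charpoly_mul_comm' A B)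
  simp only [Polynomial.eval_mul, Polynomial.eval_pow, Polynomial.eval_X] at h
  simp only [Polynomial.IsRoot.def]
  constructor <;> intro h0 <;> simpa [h0, hx] using h

open scoped Matrix in
/-- The nonzero spectrum of `∑ ℓ, d ℓ |e ℓ⟩⟨e ℓ|`, for `e` orthonormal and `d` nonvanishing, is the
range of `d`. -/
theorem spectrum_diff_zero_of_orthonormal_expansion {ι L : Type*} [Fintype ι] [DecidableEq ι]
    [Fintype L] [DecidableEq L] {e : L → ι → ℂ} {d : L → ℂ} {ρ : Matrix ι ι ℂ}
    (he : ∀ ℓ ℓ', ∑ x, star (e ℓ x) * e ℓ' x = if ℓ = ℓ' then (1 : ℂ) else 0)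
    (hd : ∀ ℓ, d ℓ ≠ 0)
    (hρ : ∀ x y, ρ x y = ∑ ℓ, d ℓ * e ℓ x * star (e ℓ y)) :
    spectrum ℂ ρ \ {0} = {x : ℂ | ∃ ℓ, x = d ℓ} := by
  let E : Matrix ι L ℂ := (Matrix.of e)ᵀ
  have hE : Eᴴ * E = 1 := by
    ext ℓ ℓ'
    simpa [E, Matrix.mul_apply, Matrix.one_apply] using he ℓ ℓ'
  have hfac : ρ = E * (Matrix.diagonal d * Eᴴ) := by
    ext x y
    rw [hρ, Matrix.mul_apply]
    refine Finset.sum_congr rfl fun ℓ _ => ?_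
    simp [E, Matrix.diagonal_mul]
    ring
  rw [hfac, Matrix.spectrum_mul_comm_diff_zero, Matrix.mul_assoc, hE, Matrix.mul_one,
    spectrum_diagonal]
  ext x
  simp only [Set.mem_sdiff, Set.mem_range, Set.mem_singleton_iff, Set.mem_ofPred_eq]
  constructor
  · rintro ⟨⟨ℓ, rfl⟩, -⟩
    exact ⟨ℓ, rfl⟩
  · rintro ⟨ℓ, rfl⟩
    exact ⟨⟨ℓ, rfl⟩, hd ℓ⟩

/-- Tracing out the second factor of a bipartite Schmidt decomposition. -/
theorem partial_trace_of_schmidt {ι κ L : Type*} [Fintype κ] [Fintype L] [DecidableEq L]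
    {e : L → ι → ℂ} {f : L → κ → ℂ} {c : L → ℝ} {b : ι → κ → ℂ}
    (hf : ∀ ℓ ℓ', ∑ y, star (f ℓ y) * f ℓ' y = if ℓ = ℓ' then (1 : ℂ) else 0)
    (hb : ∀ x y, b x y = ∑ ℓ, (c ℓ : ℂ) * e ℓ x * f ℓ y) (x x' : ι) :
    ∑ y, b x y * star (b x' y) = ∑ ℓ, (c ℓ : ℂ) ^ 2 * e ℓ x * star (e ℓ x') := by
  calc ∑ y, b x y * star (b x' y)
      = ∑ y, ∑ ℓ, ∑ ℓ', ((c ℓ : ℂ) * e ℓ x * ((c ℓ' : ℂ) * star (e ℓ' x'))) *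
          (star (f ℓ' y) * f ℓ y) := by
        refine Finset.sum_congr rfl fun y _ => ?_
        rw [hb, hb, star_sum, Finset.sum_mul_sum]
        refine Finset.sum_congr rfl fun ℓ _ => Finset.sum_congr rfl fun ℓ' _ => ?_
        simp only [star_mul', RCLike.star_def, Complex.conj_ofReal]
        ring
    _ = ∑ ℓ, ∑ ℓ', ((c ℓ : ℂ) * e ℓ x * ((c ℓ' : ℂ) * star (e ℓ' x'))) *
          ∑ y, star (f ℓ' y) * f ℓ y := by
        rw [Finset.sum_comm]
        refine Finset.sum_congr rfl fun ℓ _ => ?_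
        rw [Finset.sum_comm]
        simp only [Finset.mul_sum]
    _ = ∑ ℓ, (c ℓ : ℂ) ^ 2 * e ℓ x * star (e ℓ x') := by
        refine Finset.sum_congr rfl fun ℓ _ => ?_
        simp only [hf, mul_ite, mul_one, mul_zero, Finset.sum_ite_eq', Finset.mem_univ, if_true]
        ring

/-- Products of orthonormal families with the same index are orthonormal. -/
theorem orthonormal_diagonal_product {ι κ L : Type*} [Fintype ι] [Fintype κ] [DecidableEq L]
    {e : L → ι → ℂ} {f : L → κ → ℂ}
    (he : ∀ ℓ ℓ', ∑ x, star (e ℓ x) * e ℓ' x = if ℓ = ℓ' then (1 : ℂ) else 0)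
    (hf : ∀ ℓ ℓ', ∑ y, star (f ℓ y) * f ℓ' y = if ℓ = ℓ' then (1 : ℂ) else 0) (ℓ ℓ' : L) :
    ∑ p : ι × κ, star (e ℓ p.1 * f ℓ p.2) * (e ℓ' p.1 * f ℓ' p.2) =
      if ℓ = ℓ' then (1 : ℂ) else 0 := by
  calc ∑ p : ι × κ, star (e ℓ p.1 * f ℓ p.2) * (e ℓ' p.1 * f ℓ' p.2)
      = (∑ x, star (e ℓ x) * e ℓ' x) * ∑ y, star (f ℓ y) * f ℓ' y := by
        rw [Fintype.sum_prod_type, Finset.sum_mul_sum]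
        refine Finset.sum_congr rfl fun x _ => Finset.sum_congr rfl fun y _ => ?_
        rw [star_mul']
        ring
    _ = if ℓ = ℓ' then (1 : ℂ) else 0 := by
        rw [he, hf]
        split_ifs <;> simp

/-- For a Schmidt decomposable tripartite state, the reduced density
matrix of the joint subsystem AB is `ρ_AB (i,j) (l,m) = ∑ ℓ, (λ ℓ)^2 (u ℓ i)(v ℓ j) conj((u ℓ l)(v ℓ m))`,
and all six reduced density matrices have the same nonzero eigenvalues `(λ ℓ)^2`. -/
theorem schmidt_reduced_density_AB_and_equal_spectra
    (d₁ d₂ d₃ r : ℕ)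
    (a : Fin d₁ → Fin d₂ → Fin d₃ → ℂ)
    (c : Fin r → ℝ)
    (u : Fin r → Fin d₁ → ℂ) (v : Fin r → Fin d₂ → ℂ) (w : Fin r → Fin d₃ → ℂ)
    (hc : ∀ ℓ, 0 < c ℓ)
    (hu : ∀ ℓ ℓ', ∑ i, star (u ℓ i) * u ℓ' i = if ℓ = ℓ' then (1 : ℂ) else 0)
    (hv : ∀ ℓ ℓ', ∑ j, star (v ℓ j) * v ℓ' j = if ℓ = ℓ' then (1 : ℂ) else 0)
    (hw : ∀ ℓ ℓ', ∑ k, star (w ℓ k) * w ℓ' k = if ℓ = ℓ' then (1 : ℂ) else 0)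
    (ha : ∀ i j k, a i j k = ∑ ℓ, (c ℓ : ℂ) * u ℓ i * v ℓ j * w ℓ k)
    -- the six reduced density matrices
    (ρA : Matrix (Fin d₁) (Fin d₁) ℂ)
    (ρB : Matrix (Fin d₂) (Fin d₂) ℂ)
    (ρC : Matrix (Fin d₃) (Fin d₃) ℂ)
    (ρAB : Matrix (Fin d₁ × Fin d₂) (Fin d₁ × Fin d₂) ℂ)
    (ρAC : Matrix (Fin d₁ × Fin d₃) (Fin d₁ × Fin d₃) ℂ)
    (ρBC : Matrix (Fin d₂ × Fin d₃) (Fin d₂ × Fin d₃) ℂ)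
    (hρA : ∀ i l, ρA i l = ∑ j, ∑ k, a i j k * star (a l j k))
    (hρB : ∀ j m, ρB j m = ∑ i, ∑ k, a i j k * star (a i m k))
    (hρC : ∀ k n, ρC k n = ∑ i, ∑ j, a i j k * star (a i j n))
    (hρAB : ∀ i j l m, ρAB (i, j) (l, m) = ∑ k, a i j k * star (a l m k))
    (hρAC : ∀ i k l n, ρAC (i, k) (l, n) = ∑ j, a i j k * star (a l j n))
    (hρBC : ∀ j k m n, ρBC (j, k) (m, n) = ∑ i, a i j k * star (a i m n)) :
    (∀ i j l m, ρAB (i, j) (l, m) =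
        ∑ ℓ, ((c ℓ : ℂ)) ^ 2 * (u ℓ i * v ℓ j) * star (u ℓ l * v ℓ m)) ∧
    (spectrum ℂ ρA \ {0} = {x : ℂ | ∃ ℓ, x = ((c ℓ : ℂ)) ^ 2} ∧
     spectrum ℂ ρB \ {0} = {x : ℂ | ∃ ℓ, x = ((c ℓ : ℂ)) ^ 2} ∧
     spectrum ℂ ρC \ {0} = {x : ℂ | ∃ ℓ, x = ((c ℓ : ℂ)) ^ 2} ∧
     spectrum ℂ ρAB \ {0} = {x : ℂ | ∃ ℓ, x = ((c ℓ : ℂ)) ^ 2} ∧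
     spectrum ℂ ρAC \ {0} = {x : ℂ | ∃ ℓ, x = ((c ℓ : ℂ)) ^ 2} ∧
     spectrum ℂ ρBC \ {0} = {x : ℂ | ∃ ℓ, x = ((c ℓ : ℂ)) ^ 2}) := by
  have hd : ∀ ℓ, (c ℓ : ℂ) ^ 2 ≠ 0 := fun ℓ =>
    pow_ne_zero 2 (Complex.ofReal_ne_zero.mpr (hc ℓ).ne')
  have huv := orthonormal_diagonal_product hu hv
  have huw := orthonormal_diagonal_product hu hw
  have hvw := orthonormal_diagonal_product hv hw
  have hA := partial_trace_of_schmidt (e := u) (c := c) (b := fun i p => a i p.1 p.2) hvw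
    fun i p => by simp only [ha, mul_assoc]
  have hB := partial_trace_of_schmidt (e := v) (c := c) (b := fun j p => a p.1 j p.2) huw
    fun j p => by simp only [ha, mul_assoc, mul_left_comm]
  have hC := partial_trace_of_schmidt (e := w) (c := c) (b := fun k p => a p.1 p.2 k) huv
    fun k p => by
      rw [ha]
      exact Finset.sum_congr rfl fun ℓ _ => by ring
  have hAB := partial_trace_of_schmidt (e := fun ℓ (p : _ × _) => u ℓ p.1 * v ℓ p.2) (c := c)
    (b := fun (p : _ × _) k => a p.1 p.2 k) hw fun p k => by simp only [ha, mul_assoc]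
  have hAC := partial_trace_of_schmidt (e := fun ℓ (p : _ × _) => u ℓ p.1 * w ℓ p.2) (c := c)
    (b := fun (p : _ × _) j => a p.1 j p.2) hv fun p j => by
      rw [ha]
      exact Finset.sum_congr rfl fun ℓ _ => by ring
  have hBC := partial_trace_of_schmidt (e := fun ℓ (p : _ × _) => v ℓ p.1 * w ℓ p.2) (c := c)
    (b := fun (p : _ × _) i => a i p.1 p.2) hu fun p i => by
      rw [ha]
      exact Finset.sum_congr rfl fun ℓ _ => by ring
  simp only [Fintype.sum_prod_type] at hA hB hC
  refine ⟨fun i j l m => (hρAB i j l m).trans (hAB (i, j) (l, m)), ?_, ?_, ?_, ?_, ?_, ?_⟩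
  · exact spectrum_diff_zero_of_orthonormal_expansion hu hd fun i l => (hρA i l).trans (hA i l)
  · exact spectrum_diff_zero_of_orthonormal_expansion hv hd fun j m => (hρB j m).trans (hB j m)
  · exact spectrum_diff_zero_of_orthonormal_expansion hw hd fun k n => (hρC k n).trans (hC k n)
  · exact spectrum_diff_zero_of_orthonormal_expansion huv hd
      fun p q => (hρAB p.1 p.2 q.1 q.2).trans (hAB p q)
  · exact spectrum_diff_zero_of_orthonormal_expansion huw hd
      fun p q => (hρAC p.1 p.2 q.1 q.2).trans (hAC p q)
  · exact spectrum_diff_zero_of_orthonormal_expansion hvw hd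
      fun p q => (hρBC p.1 p.2 q.1 q.2).trans (hBC p q)
end

section
/- The tripartite W state, whose coefficient tensor a : Fin 2 → Fin 2 → Fin 2 → ℂ satisfies a 0 0 1 = a 0 1 0 = a 1 0 0 = 1/√3 and a i j k = 0 otherwise, admits no Schmidt decomposition: there exist no r, no positive reals λ_1, …, λ_r, and no orthonormal families (u_ℓ), (v_ℓ), (w_ℓ) in ℂ² such that a i j k = ∑_{ℓ=1}^{r} λ_ℓ · (u_ℓ i) · (v_ℓ j) · (w_ℓ k) for all i, j, k. -/
open scoped BigOperators

/-- An orthonormal family in `ℂⁿ` has at most `n` members. -/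
theorem le_of_orthonormal_family {r n : ℕ} (u : Fin r → Fin n → ℂ)
    (hu : ∀ ℓ ℓ', ∑ i, star (u ℓ i) * u ℓ' i = if ℓ = ℓ' then (1 : ℂ) else 0) : r ≤ n := by
  have h : Orthonormal ℂ fun ℓ => WithLp.toLp 2 (u ℓ) := by
    rw [orthonormal_iff_ite]
    intro ℓ ℓ'
    rw [← hu ℓ ℓ', PiLp.inner_apply]
    exact Finset.sum_congr rfl fun i _ => mul_comm _ _
  simpa using h.linearIndependent.fintype_card_le_finrank

/-- The matrix whose rows form an orthonormal family is invertible. -/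
theorem det_ne_zero_of_orthonormal_family {n : ℕ} (u : Fin n → Fin n → ℂ)
    (hu : ∀ ℓ ℓ', ∑ i, star (u ℓ i) * u ℓ' i = if ℓ = ℓ' then (1 : ℂ) else 0) :
    (Matrix.of u).det ≠ 0 := by
  have h : Matrix.of u * (Matrix.of u).conjTranspose = 1 := by
    ext ℓ ℓ'
    simp only [Matrix.mul_apply, Matrix.conjTranspose_apply, Matrix.of_apply, Matrix.one_apply,
      mul_comm (u ℓ _), hu, eq_comm]
  exact Matrix.det_ne_zero_of_right_inverse h

/-- Cayley's hyperdeterminant of a `2 × 2 × 2` tensor. -/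
def hyperdet (a : Fin 2 → Fin 2 → Fin 2 → ℂ) : ℂ :=
  (a 0 0 0 * a 1 1 1 + a 1 0 0 * a 0 1 1 - a 0 0 1 * a 1 1 0 - a 1 0 1 * a 0 1 0) ^ 2
    - 4 * (a 0 0 0 * a 0 1 1 - a 0 0 1 * a 0 1 0) * (a 1 0 0 * a 1 1 1 - a 1 0 1 * a 1 1 0)

/-- The hyperdeterminant of a sum of two product tensors. -/
theorem hyperdet_of_sum_two {a : Fin 2 → Fin 2 → Fin 2 → ℂ} (c : Fin 2 → ℂ)
    (u v w : Fin 2 → Fin 2 → ℂ)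
    (ha : ∀ i j k, a i j k = ∑ ℓ, c ℓ * u ℓ i * v ℓ j * w ℓ k) :
    hyperdet a = (c 0 * c 1 * (Matrix.of u).det * (Matrix.of v).det * (Matrix.of w).det) ^ 2 := by
  simp only [hyperdet, ha, Fin.sum_univ_two, Matrix.det_fin_two, Matrix.of_apply]
  ring

/-- The tripartite W state admits no Schmidt decomposition. -/
theorem W_state_not_schmidt_decomposable
    (a : Fin 2 → Fin 2 → Fin 2 → ℂ)
    (ha001 : a 0 0 1 = (1 / Real.sqrt 3 : ℝ))
    (ha010 : a 0 1 0 = (1 / Real.sqrt 3 : ℝ))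
    (ha100 : a 1 0 0 = (1 / Real.sqrt 3 : ℝ))
    (ha0 : ∀ i j k : Fin 2, ¬ ((i, j, k) = (0, 0, 1) ∨ (i, j, k) = (0, 1, 0) ∨
        (i, j, k) = (1, 0, 0)) → a i j k = 0) :
    ¬ ∃ (r : ℕ) (c : Fin r → ℝ)
        (u : Fin r → Fin 2 → ℂ) (v : Fin r → Fin 2 → ℂ) (w : Fin r → Fin 2 → ℂ),
      (∀ ℓ, 0 < c ℓ) ∧
      (∀ ℓ ℓ', ∑ i, star (u ℓ i) * u ℓ' i = if ℓ = ℓ' then (1 : ℂ) else 0) ∧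
      (∀ ℓ ℓ', ∑ j, star (v ℓ j) * v ℓ' j = if ℓ = ℓ' then (1 : ℂ) else 0) ∧
      (∀ ℓ ℓ', ∑ k, star (w ℓ k) * w ℓ' k = if ℓ = ℓ' then (1 : ℂ) else 0) ∧
      (∀ i j k, a i j k = ∑ ℓ, (c ℓ : ℂ) * u ℓ i * v ℓ j * w ℓ k) := by
  rintro ⟨r, c, u, v, w, hc, hu, hv, hw, ha⟩
  have hs : ((1 / Real.sqrt 3 : ℝ) : ℂ) ≠ 0 := by
    rw [Complex.ofReal_ne_zero]; positivity
  have h000 : a 0 0 0 = 0 := ha0 0 0 0 (by decide)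
  have h011 : a 0 1 1 = 0 := ha0 0 1 1 (by decide)
  have h101 : a 1 0 1 = 0 := ha0 1 0 1 (by decide)
  have h110 : a 1 1 0 = 0 := ha0 1 1 0 (by decide)
  have h111 : a 1 1 1 = 0 := ha0 1 1 1 (by decide)
  have hr := le_of_orthonormal_family u hu
  interval_cases r
  · apply hs
    rw [← ha001, ha, Fin.sum_univ_zero]
  · have h : a 0 0 1 * a 0 1 0 = a 0 0 0 * a 0 1 1 := by
      simp only [ha, Fin.sum_univ_one]
      ring
    rw [ha001, ha010, h000, zero_mul] at h
    exact mul_ne_zero hs hs h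
  · have h : hyperdet a = 0 := by
      simp [hyperdet, h000, h011, h101, h110, h111]
    rw [hyperdet_of_sum_two (fun ℓ => (c ℓ : ℂ)) u v w ha] at h
    have hc' (ℓ) : (c ℓ : ℂ) ≠ 0 := Complex.ofReal_ne_zero.2 (hc ℓ).ne'
    simp [hc', det_ne_zero_of_orthonormal_family u hu, det_ne_zero_of_orthonormal_family v hv,
      det_ne_zero_of_orthonormal_family w hw] at h
end

section
/- Let a, b : Fin d₁ → Fin d₂ → Fin d₃ → ℂ be coefficient tensors of two tripartite states which admit Schmidt decompositions with the same Schmidt coefficients: a i j k = ∑_{ℓ=1}^{r} λ_ℓ · (u_ℓ i)(v_ℓ j)(w_ℓ k) and b i j k = ∑_{ℓ=1}^{r} λ_ℓ · (u'_ℓ i)(v'_ℓ j)(w'_ℓ k), where λ_ℓ > 0 and all six families (u_ℓ), (v_ℓ), (w_ℓ), (u'_ℓ), (v'_ℓ), (w'_ℓ) are orthonormal. Then there exist unitary matrices U, V, W of sizes d₁, d₂, d₃ such that b i j k = ∑_{i',j',k'} U i i' · V j j' · W k k' · a i' j' k' for all i, j, k, i.e. |ψ_b⟩ = (U ⊗ V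 ⊗ W)|ψ_a⟩. -/
open scoped BigOperators

/-- A family of coordinate vectors satisfying the orthonormality relations is orthonormal in
`EuclideanSpace`. -/
theorem orthonormal_toLp {ι n : Type*} [DecidableEq ι] [Fintype n] (u : ι → n → ℂ)
    (hu : ∀ k l, ∑ i, star (u k i) * u l i = if k = l then (1 : ℂ) else 0) :
    Orthonormal ℂ fun l => (WithLp.toLp 2 (u l) : EuclideanSpace ℂ n) := by
  rw [orthonormal_iff_ite]
  intro k l
  rw [← hu k l, PiLp.inner_apply]
  exact Finset.sum_congr rfl fun i _ => mul_comm _ _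

/-- An orthonormal family in `ℂⁿ`, indexed along an embedding into `n`, consists of columns of a
unitary matrix. -/
theorem exists_unitary_with_columns {ι n : Type*} [DecidableEq ι] [Fintype n] [DecidableEq n]
    (e : ι ↪ n) (u : ι → n → ℂ)
    (hu : ∀ k l, ∑ i, star (u k i) * u l i = if k = l then (1 : ℂ) else 0) :
    ∃ B ∈ Matrix.unitaryGroup n ℂ, ∀ l i, B i (e l) = u l i := by
  let f : n → EuclideanSpace ℂ n := Function.extend e (fun l => WithLp.toLp 2 (u l)) 0
  have hf : ∀ l, f (e l) = WithLp.toLp 2 (u l) := fun l => e.injective.extend_apply _ _ l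
  have horth : Orthonormal ℂ ((Set.range e).domRestrict f) := by
    convert (orthonormal_toLp u hu).comp _ (Equiv.ofInjective e e.injective).symm.injective
      using 1
    ext1 x
    obtain ⟨l, rfl⟩ := (Equiv.ofInjective e e.injective).surjective x
    simp [hf]
  obtain ⟨b, hb⟩ := horth.exists_orthonormalBasis_extension_of_card_eq (by simp)
  refine ⟨Matrix.of fun i j => b j i, ?_, fun l i => ?_⟩
  · rw [Matrix.mem_unitaryGroup_iff']
    ext k l
    rw [Matrix.one_apply, ← orthonormal_iff_ite.mp b.orthonormal k l, PiLp.inner_apply,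
      Matrix.mul_apply]
    exact Finset.sum_congr rfl fun i _ => mul_comm _ _
  · simp [hb (e l) ⟨l, rfl⟩, hf]

/-- The cardinality of an orthonormal family in `ℂⁿ` is at most the dimension. -/
theorem card_le_of_sum_star_mul_eq_ite {ι n : Type*} [Fintype ι] [DecidableEq ι] [Fintype n]
    (u : ι → n → ℂ)
    (hu : ∀ k l, ∑ i, star (u k i) * u l i = if k = l then (1 : ℂ) else 0) :
    Fintype.card ι ≤ Fintype.card n := by
  simpa using (orthonormal_toLp u hu).linearIndependent.fintype_card_le_finrank

/-- Two orthonormal families in `ℂⁿ` with the same index type are related by a unitary matrix. -/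
theorem exists_unitary_mulVec_eq {ι n : Type*} [Fintype ι] [DecidableEq ι] [Fintype n]
    [DecidableEq n] (u u' : ι → n → ℂ)
    (hu : ∀ k l, ∑ i, star (u k i) * u l i = if k = l then (1 : ℂ) else 0)
    (hu' : ∀ k l, ∑ i, star (u' k i) * u' l i = if k = l then (1 : ℂ) else 0) :
    ∃ U ∈ Matrix.unitaryGroup n ℂ, ∀ l i, ∑ j, U i j * u l j = u' l i := by
  obtain ⟨e⟩ := Function.Embedding.nonempty_of_card_le (card_le_of_sum_star_mul_eq_ite u hu)
  obtain ⟨B, hB, hBu⟩ := exists_unitary_with_columns e u hu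
  obtain ⟨B', hB', hBu'⟩ := exists_unitary_with_columns e u' hu'
  refine ⟨B' * star B, mul_mem hB' (Unitary.star_mem hB), fun l i => ?_⟩
  have h : B' * star B * B = B' := by
    rw [mul_assoc, Matrix.mem_unitaryGroup_iff'.mp hB, mul_one]
  simp_rw [← hBu, ← hBu']
  rw [← Matrix.mul_apply, h]

/-- Two Schmidt decomposable tripartite states with the same Schmidt
coefficients are related by a separable unitary `U ⊗ V ⊗ W`. -/
theorem same_schmidt_coefficients_local_unitary
    (d₁ d₂ d₃ r : ℕ)
    (a b : Fin d₁ → Fin d₂ → Fin d₃ → ℂ)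
    (c : Fin r → ℝ)
    (u u' : Fin r → Fin d₁ → ℂ) (v v' : Fin r → Fin d₂ → ℂ)
    (w w' : Fin r → Fin d₃ → ℂ)
    (hc : ∀ ℓ, 0 < c ℓ)
    (hu : ∀ ℓ ℓ', ∑ i, star (u ℓ i) * u ℓ' i = if ℓ = ℓ' then (1 : ℂ) else 0)
    (hv : ∀ ℓ ℓ', ∑ j, star (v ℓ j) * v ℓ' j = if ℓ = ℓ' then (1 : ℂ) else 0)
    (hw : ∀ ℓ ℓ', ∑ k, star (w ℓ k) * w ℓ' k = if ℓ = ℓ' then (1 : ℂ) else 0)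
    (hu' : ∀ ℓ ℓ', ∑ i, star (u' ℓ i) * u' ℓ' i = if ℓ = ℓ' then (1 : ℂ) else 0)
    (hv' : ∀ ℓ ℓ', ∑ j, star (v' ℓ j) * v' ℓ' j = if ℓ = ℓ' then (1 : ℂ) else 0)
    (hw' : ∀ ℓ ℓ', ∑ k, star (w' ℓ k) * w' ℓ' k = if ℓ = ℓ' then (1 : ℂ) else 0)
    (ha : ∀ i j k, a i j k = ∑ ℓ, (c ℓ : ℂ) * u ℓ i * v ℓ j * w ℓ k)
    (hb : ∀ i j k, b i j k = ∑ ℓ, (c ℓ : ℂ) * u' ℓ i * v' ℓ j * w' ℓ k) :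
    ∃ (U : Matrix (Fin d₁) (Fin d₁) ℂ) (V : Matrix (Fin d₂) (Fin d₂) ℂ)
      (W : Matrix (Fin d₃) (Fin d₃) ℂ),
      U ∈ Matrix.unitaryGroup (Fin d₁) ℂ ∧
      V ∈ Matrix.unitaryGroup (Fin d₂) ℂ ∧
      W ∈ Matrix.unitaryGroup (Fin d₃) ℂ ∧
      ∀ i j k, b i j k = ∑ i', ∑ j', ∑ k', U i i' * V j j' * W k k' * a i' j' k' := by
  obtain ⟨U, hU, hUu⟩ := exists_unitary_mulVec_eq u u' hu hu'
  obtain ⟨V, hV, hVv⟩ := exists_unitary_mulVec_eq v v' hv hv'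
  obtain ⟨W, hW, hWw⟩ := exists_unitary_mulVec_eq w w' hw hw'
  refine ⟨U, V, W, hU, hV, hW, fun i j k => ?_⟩
  simp_rw [hb, ha, ← hUu, ← hVv, ← hWw]
  calc
    _ = ∑ ℓ, ∑ i', ∑ j', ∑ k',
        U i i' * V j j' * W k k' * ((c ℓ : ℂ) * u ℓ i' * v ℓ j' * w ℓ k') := by
      refine Finset.sum_congr rfl fun ℓ _ => ?_
      rw [Finset.mul_sum _ _ (c ℓ : ℂ), Finset.sum_mul, Finset.sum_mul]
      refine Finset.sum_congr rfl fun i' _ => ?_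
      rw [Finset.mul_sum _ _ ((c ℓ : ℂ) * _), Finset.sum_mul]
      refine Finset.sum_congr rfl fun j' _ => ?_
      rw [Finset.mul_sum]
      exact Finset.sum_congr rfl fun k' _ => by ring
    _ = _ := by
      rw [Finset.sum_comm]
      refine Finset.sum_congr rfl fun i' _ => ?_
      rw [Finset.sum_comm]
      refine Finset.sum_congr rfl fun j' _ => ?_
      rw [Finset.sum_comm]
      exact Finset.sum_congr rfl fun k' _ => (Finset.mul_sum _ _ _).symm
end

section
/- Let a : Fin d₁ → Fin d₂ → Fin d₃ → ℂ admit a Schmidt decomposition a i j k = ∑_{ℓ=1}^{r} λ_ℓ · (u_ℓ i)(v_ℓ j)(w_ℓ k) with λ_ℓ > 0 and orthonormal families (u_ℓ), (v_ℓ), (w_ℓ). Then the Schmidt number r equals the rank of the reduced density matrix of any subsystem; in particular, r = rank ρ_A = rank ρ_{AB}, where (ρ_A) i l = ∑_{j,k} a i j k · conj(a l j k) and (ρ_{AB}) (i,j) (l,m) = ∑_k a i j k · conj(a l m k). -/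
open scoped BigOperators
open Matrix

/-- A matrix with a Schmidt decomposition with nonzero coefficients has rank the number of
its terms. -/
lemma rank_eq_of_schmidt_decomposition {m n ι : Type*} [Fintype m] [Fintype n] [Fintype ι]
    [DecidableEq ι] (M : Matrix m n ℂ) (c : ι → ℂ) (x : ι → m → ℂ) (y : ι → n → ℂ)
    (hc : ∀ ℓ, c ℓ ≠ 0)
    (hx : ∀ ℓ ℓ', ∑ p, star (x ℓ p) * x ℓ' p = if ℓ = ℓ' then (1 : ℂ) else 0)
    (hy : ∀ ℓ ℓ', ∑ q, star (y ℓ q) * y ℓ' q = if ℓ = ℓ' then (1 : ℂ) else 0)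
    (hM : ∀ p q, M p q = ∑ ℓ, c ℓ * x ℓ p * y ℓ q) :
    M.rank = Fintype.card ι := by
  let X : Matrix m ι ℂ := Matrix.of fun p ℓ => x ℓ p
  let Y : Matrix ι n ℂ := Matrix.of y
  have hX : Xᴴ * X = 1 := by
    ext ℓ ℓ'
    simpa [X, Matrix.mul_apply, Matrix.one_apply] using hx ℓ ℓ'
  have hY : Y * Yᴴ = 1 := by
    ext ℓ ℓ'
    simpa [Y, Matrix.mul_apply, Matrix.one_apply, mul_comm, eq_comm] using hy ℓ' ℓ
  have hfac : M = X * (diagonal c * Y) := by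
    ext p q
    rw [hM, Matrix.mul_apply]
    refine Finset.sum_congr rfl fun ℓ _ => ?_
    simp only [X, Y, Matrix.diagonal_mul, Matrix.of_apply]
    ring
  have hdiag : Xᴴ * M * Yᴴ = diagonal c := by
    rw [hfac, ← Matrix.mul_assoc, hX, Matrix.one_mul, Matrix.mul_assoc, hY, Matrix.mul_one]
  apply le_antisymm
  · rw [hfac]
    exact (Matrix.rank_mul_le_left _ _).trans (Matrix.rank_le_card_width _)
  · calc Fintype.card ι = (diagonal c).rank := by simp [Matrix.rank_diagonal, hc]
      _ = (Xᴴ * M * Yᴴ).rank := by rw [hdiag]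
      _ ≤ (Xᴴ * M).rank := Matrix.rank_mul_le_left _ _
      _ ≤ M.rank := Matrix.rank_mul_le_right _ _

/-- Products of two orthonormal families along the diagonal are orthonormal. -/
lemma sum_star_mul_prod_eq_ite {m n ι : Type*} [Fintype m] [Fintype n] [DecidableEq ι]
    {x : ι → m → ℂ} {y : ι → n → ℂ}
    (hx : ∀ ℓ ℓ', ∑ p, star (x ℓ p) * x ℓ' p = if ℓ = ℓ' then (1 : ℂ) else 0)
    (hy : ∀ ℓ ℓ', ∑ q, star (y ℓ q) * y ℓ' q = if ℓ = ℓ' then (1 : ℂ) else 0) (ℓ ℓ' : ι) :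
    ∑ p : m × n, star (x ℓ p.1 * y ℓ p.2) * (x ℓ' p.1 * y ℓ' p.2) =
      if ℓ = ℓ' then (1 : ℂ) else 0 := by
  calc _ = (∑ p, star (x ℓ p) * x ℓ' p) * ∑ q, star (y ℓ q) * y ℓ' q := by
        rw [Finset.sum_mul_sum, Fintype.sum_prod_type]
        refine Finset.sum_congr rfl fun p _ => Finset.sum_congr rfl fun q _ => ?_
        rw [star_mul']
        ring
    _ = _ := by rw [hx, hy]; split_ifs <;> simp

/-- For a Schmidt decomposable tripartite state, the Schmidt number `r`
equals the rank of the reduced density matrices `ρ_A` and `ρ_AB`. -/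
theorem schmidt_number_eq_rank_reduced
    (d₁ d₂ d₃ r : ℕ)
    (a : Fin d₁ → Fin d₂ → Fin d₃ → ℂ)
    (c : Fin r → ℝ)
    (u : Fin r → Fin d₁ → ℂ) (v : Fin r → Fin d₂ → ℂ) (w : Fin r → Fin d₃ → ℂ)
    (hc : ∀ ℓ, 0 < c ℓ)
    (hu : ∀ ℓ ℓ', ∑ i, star (u ℓ i) * u ℓ' i = if ℓ = ℓ' then (1 : ℂ) else 0)
    (hv : ∀ ℓ ℓ', ∑ j, star (v ℓ j) * v ℓ' j = if ℓ = ℓ' then (1 : ℂ) else 0)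
    (hw : ∀ ℓ ℓ', ∑ k, star (w ℓ k) * w ℓ' k = if ℓ = ℓ' then (1 : ℂ) else 0)
    (ha : ∀ i j k, a i j k = ∑ ℓ, (c ℓ : ℂ) * u ℓ i * v ℓ j * w ℓ k) :
    r = (Matrix.of fun i l => ∑ j, ∑ k, a i j k * star (a l j k)).rank ∧
    r = (Matrix.of fun (p : Fin d₁ × Fin d₂) (q : Fin d₁ × Fin d₂) =>
          ∑ k, a p.1 p.2 k * star (a q.1 q.2 k)).rank := by
  have hc' : ∀ ℓ, (c ℓ : ℂ) ≠ 0 := fun ℓ => Complex.ofReal_ne_zero.mpr (hc ℓ).ne'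
  constructor
  · let M : Matrix (Fin d₁) (Fin d₂ × Fin d₃) ℂ := Matrix.of fun i q => a i q.1 q.2
    have hM : M.rank = Fintype.card (Fin r) :=
      rank_eq_of_schmidt_decomposition M (fun ℓ => (c ℓ : ℂ)) u (fun ℓ q => v ℓ q.1 * w ℓ q.2)
        hc' hu (sum_star_mul_prod_eq_ite hv hw) fun i q => by simp [M, ha, mul_assoc]
    have hρ : (Matrix.of fun i l => ∑ j, ∑ k, a i j k * star (a l j k)) = M * Mᴴ := by
      ext i l
      simp [M, Matrix.mul_apply, Fintype.sum_prod_type]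
    open scoped ComplexOrder in
    rw [hρ, Matrix.rank_self_mul_conjTranspose, hM, Fintype.card_fin]
  · let M : Matrix (Fin d₁ × Fin d₂) (Fin d₃) ℂ := Matrix.of fun p k => a p.1 p.2 k
    have hM : M.rank = Fintype.card (Fin r) :=
      rank_eq_of_schmidt_decomposition M (fun ℓ => (c ℓ : ℂ)) (fun ℓ p => u ℓ p.1 * v ℓ p.2) w
        hc' (sum_star_mul_prod_eq_ite hu hv) hw fun p k => by simp [M, ha, mul_assoc]
    have hρ : (Matrix.of fun (p : Fin d₁ × Fin d₂) (q : Fin d₁ × Fin d₂) =>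
        ∑ k, a p.1 p.2 k * star (a q.1 q.2 k)) = M * Mᴴ := by
      ext p q
      simp [M, Matrix.mul_apply]
    open scoped ComplexOrder in
    rw [hρ, Matrix.rank_self_mul_conjTranspose, hM, Fintype.card_fin]
end

section
/- Any two purifications of the same density matrix with the same purifying system are related by a unitary acting only on the purifying system: if Ψ₁, Ψ₂ : Matrix (Fin d) (Fin r) ℂ satisfy Ψ₁ Ψ₁ᴴ = Ψ₂ Ψ₂ᴴ (= ρ), then there exists a unitary matrix U : Matrix (Fin r) (Fin r) ℂ such that Ψ₁ = Ψ₂ U; equivalently |AR₁⟩ = (I ⊗ Uᵀ)|AR₂⟩. -/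
open scoped BigOperators
open Matrix

/-- Linear maps with pointwise equal norms differ by a linear isometry of the codomain. -/
theorem LinearMap.exists_linearIsometry_comp_eq_of_norm_eq {𝕜 E V : Type*} [RCLike 𝕜]
    [AddCommGroup E] [Module 𝕜 E] [NormedAddCommGroup V] [InnerProductSpace 𝕜 V]
    [FiniteDimensional 𝕜 V] (f g : E →ₗ[𝕜] V) (h : ∀ x, ‖f x‖ = ‖g x‖) :
    ∃ L : V →ₗᵢ[𝕜] V, L.toLinearMap ∘ₗ g = f := by
  have hker : g.ker ≤ f.ker := fun x hx => by
    rw [LinearMap.mem_ker] at hx ⊢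
    rw [← norm_eq_zero, h, hx, norm_zero]
  let T : g.range →ₗ[𝕜] V := g.ker.liftQ f hker ∘ₗ g.quotKerEquivRange.symm.toLinearMap
  have hT : ∀ x, T ⟨g x, g.mem_range_self x⟩ = f x := fun x => by
    simp [T, LinearMap.quotKerEquivRange_symm_apply_image]
  let S : g.range →ₗᵢ[𝕜] V := ⟨T, by
    rintro ⟨_, x, rfl⟩
    rw [hT, h, Submodule.coe_norm]⟩
  refine ⟨S.extend, LinearMap.ext fun x => ?_⟩
  exact (S.extend_apply ⟨g x, g.mem_range_self x⟩).trans (hT x)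

/-- Linear maps with the same Gram operator have pointwise equal norms. -/
theorem LinearMap.norm_eq_of_adjoint_comp_self_eq {𝕜 E V : Type*} [RCLike 𝕜]
    [NormedAddCommGroup E] [InnerProductSpace 𝕜 E] [FiniteDimensional 𝕜 E]
    [NormedAddCommGroup V] [InnerProductSpace 𝕜 V] [FiniteDimensional 𝕜 V] {f g : E →ₗ[𝕜] V}
    (h : f.adjoint ∘ₗ f = g.adjoint ∘ₗ g) (x : E) : ‖f x‖ = ‖g x‖ := by
  have hx := congrArg (inner 𝕜 x) (LinearMap.congr_fun h x)
  simp only [LinearMap.comp_apply, LinearMap.adjoint_inner_right] at hx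
  rw [@norm_eq_sqrt_re_inner 𝕜, hx, ← @norm_eq_sqrt_re_inner 𝕜]

/-- Two purifications of the same density matrix with the same
purifying system are related by a unitary on the purifying system:
if `Ψ₁ Ψ₁ᴴ = Ψ₂ Ψ₂ᴴ` then `Ψ₁ = Ψ₂ U` for some unitary `U`. -/
theorem purifications_unitarily_related
    (d r : ℕ)
    (Ψ₁ Ψ₂ : Matrix (Fin d) (Fin r) ℂ)
    (h : Ψ₁ * Ψ₁ᴴ = Ψ₂ * Ψ₂ᴴ) :
    ∃ U : Matrix (Fin r) (Fin r) ℂ,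
      U ∈ Matrix.unitaryGroup (Fin r) ℂ ∧ Ψ₁ = Ψ₂ * U := by
  obtain ⟨L, hL⟩ := LinearMap.exists_linearIsometry_comp_eq_of_norm_eq
    (toEuclideanLin Ψ₁ᴴ) (toEuclideanLin Ψ₂ᴴ) <| LinearMap.norm_eq_of_adjoint_comp_self_eq <| by
      rw [← toEuclideanLin_conjTranspose_eq_adjoint, ← toEuclideanLin_conjTranspose_eq_adjoint,
        ← toLpLin_mul_same, ← toLpLin_mul_same, conjTranspose_conjTranspose,
        conjTranspose_conjTranspose, h]
  obtain ⟨W, hW⟩ := toEuclideanLin.surjective L.toLinearMap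
  have hmul : W * Ψ₂ᴴ = Ψ₁ᴴ := toEuclideanLin.injective <| by rw [toLpLin_mul_same, hW, hL]
  have hunit : Wᴴ * W = 1 := toEuclideanLin.injective <| by
    rw [toLpLin_mul_same, toEuclideanLin_conjTranspose_eq_adjoint, hW]
    simp
  refine ⟨Wᴴ, ?_, ?_⟩
  · rw [mem_unitaryGroup_iff, star_eq_conjTranspose, conjTranspose_conjTranspose, hunit]
  · simpa using (congrArg conjTranspose hmul).symm
end

section
/- Schmidt decomposability is an invariant of purification: let ρ be a density matrix of a tripartite system ABC (a positive semidefinite trace-1 matrix on ℂ^{d₁d₂d₃}), and let ψ₁, ψ₂ : Fin d₁ → Fin d₂ → Fin d₃ → Fin r → ℂ be two purifications of ρ with purifying system R of dimension r, i.e. ∑_s ψ_t i j k s · conj(ψ_t l m n s) = ρ (i,j,k) (l,m,n) for t = 1, 2. Then ψ₁ admits a 4-partite Schmidt decomposition (over the parts A, B, C, R) if and only if ψ₂ does. -/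
open scoped BigOperators
open Matrix
open scoped ComplexOrder

/-- A 4-partite coefficient tensor admits a Schmidt decomposition. -/
def SchmidtDecomposable4 {d₁ d₂ d₃ dR : ℕ}
    (ψ : Fin d₁ → Fin d₂ → Fin d₃ → Fin dR → ℂ) : Prop :=
  ∃ (p : ℕ) (c : Fin p → ℝ) (u : Fin p → Fin d₁ → ℂ) (v : Fin p → Fin d₂ → ℂ)
    (w : Fin p → Fin d₃ → ℂ) (z : Fin p → Fin dR → ℂ),
    (∀ ℓ, 0 < c ℓ) ∧
    (∀ ℓ ℓ', ∑ i, star (u ℓ i) * u ℓ' i = if ℓ = ℓ' then (1 : ℂ) else 0) ∧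
    (∀ ℓ ℓ', ∑ j, star (v ℓ j) * v ℓ' j = if ℓ = ℓ' then (1 : ℂ) else 0) ∧
    (∀ ℓ ℓ', ∑ k, star (w ℓ k) * w ℓ' k = if ℓ = ℓ' then (1 : ℂ) else 0) ∧
    (∀ ℓ ℓ', ∑ s, star (z ℓ s) * z ℓ' s = if ℓ = ℓ' then (1 : ℂ) else 0) ∧
    (∀ i j k s, ψ i j k s = ∑ ℓ, (c ℓ : ℂ) * u ℓ i * v ℓ j * w ℓ k * z ℓ s)

/-- If `Ψ Ψᴴ = (E C Z)(E C Z)ᴴ`, where `E` has orthonormal columns, `Z` has orthonormal rows and `C`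
is invertible, then `Ψ = E C Z'` for some `Z'` with orthonormal rows. -/
theorem exists_orthonormal_rows_factorization {X S n : Type*} [Fintype X] [DecidableEq X]
    [Fintype S] [Fintype n] [DecidableEq n]
    (E : Matrix X n ℂ) (C : Matrix n n ℂ) (Z : Matrix n S ℂ) (Ψ : Matrix X S ℂ)
    (hE : Eᴴ * E = 1) (hZ : Z * Zᴴ = 1) (hC : IsUnit C)
    (hΨ : Ψ * Ψᴴ = (E * C * Z) * (E * C * Z)ᴴ) :
    ∃ Z' : Matrix n S ℂ, Z' * Z'ᴴ = 1 ∧ Ψ = E * C * Z' := by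
  have hdet : IsUnit C.det := (Matrix.isUnit_iff_isUnit_det C).1 hC
  have hρ : Ψ * Ψᴴ = E * (C * Cᴴ) * Eᴴ := by
    calc Ψ * Ψᴴ = E * C * (Z * Zᴴ) * (Cᴴ * Eᴴ) := by
          rw [hΨ]; simp only [conjTranspose_mul, Matrix.mul_assoc]
      _ = E * (C * Cᴴ) * Eᴴ := by rw [hZ]; simp only [Matrix.mul_one, Matrix.mul_assoc]
  have hproj : (1 - E * Eᴴ) * E = 0 := by
    rw [Matrix.sub_mul, Matrix.mul_assoc, hE, Matrix.mul_one, Matrix.one_mul, sub_self]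
  refine ⟨C⁻¹ * Eᴴ * Ψ, ?_, ?_⟩
  · calc C⁻¹ * Eᴴ * Ψ * (C⁻¹ * Eᴴ * Ψ)ᴴ = C⁻¹ * Eᴴ * (Ψ * Ψᴴ) * (E * (C⁻¹)ᴴ) := by
          simp only [conjTranspose_mul, conjTranspose_conjTranspose, Matrix.mul_assoc]
      _ = C⁻¹ * (Eᴴ * E) * (C * Cᴴ) * (Eᴴ * E) * (C⁻¹)ᴴ := by
          rw [hρ]; simp only [Matrix.mul_assoc]
      _ = (C⁻¹ * C) * (C⁻¹ * C)ᴴ := by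
          rw [hE, conjTranspose_mul]; simp only [Matrix.mul_one, Matrix.mul_assoc]
      _ = 1 := by rw [Matrix.nonsing_inv_mul C hdet]; simp
  · have hres : (1 - E * Eᴴ) * Ψ = 0 := by
      rw [← Matrix.self_mul_conjTranspose_eq_zero]
      calc (1 - E * Eᴴ) * Ψ * ((1 - E * Eᴴ) * Ψ)ᴴ
          = (1 - E * Eᴴ) * (Ψ * Ψᴴ) * (1 - E * Eᴴ)ᴴ := by
            rw [conjTranspose_mul]; simp only [Matrix.mul_assoc]
        _ = (1 - E * Eᴴ) * E * (C * Cᴴ * Eᴴ * (1 - E * Eᴴ)ᴴ) := by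
            rw [hρ]; simp only [Matrix.mul_assoc]
        _ = 0 := by rw [hproj, Matrix.zero_mul]
    rw [Matrix.sub_mul, Matrix.one_mul, sub_eq_zero] at hres
    calc Ψ = E * (C * C⁻¹) * Eᴴ * Ψ := by rw [Matrix.mul_nonsing_inv C hdet, Matrix.mul_one, ← hres]
      _ = E * C * (C⁻¹ * Eᴴ * Ψ) := by simp only [Matrix.mul_assoc]

/-- A tensor with the same reduced density matrix on the first three parts as a Schmidt decomposable
tensor is Schmidt decomposable. -/
theorem SchmidtDecomposable4.of_partialTrace_eq {d₁ d₂ d₃ r : ℕ}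
    {ψ φ : Fin d₁ → Fin d₂ → Fin d₃ → Fin r → ℂ} (hψ : SchmidtDecomposable4 ψ)
    (h : ∀ i j k l m n,
      ∑ s, φ i j k s * star (φ l m n s) = ∑ s, ψ i j k s * star (ψ l m n s)) :
    SchmidtDecomposable4 φ := by
  obtain ⟨p, c, u, v, w, z, hc, hu, hv, hw, hz, hdec⟩ := hψ
  let E : Matrix (Fin d₁ × Fin d₂ × Fin d₃) (Fin p) ℂ :=
    Matrix.of fun x ℓ => u ℓ x.1 * v ℓ x.2.1 * w ℓ x.2.2
  let C : Matrix (Fin p) (Fin p) ℂ := Matrix.diagonal fun ℓ => (c ℓ : ℂ)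
  let Z : Matrix (Fin p) (Fin r) ℂ := Matrix.of z
  let Φ : Matrix (Fin d₁ × Fin d₂ × Fin d₃) (Fin r) ℂ :=
    Matrix.of fun x s => φ x.1 x.2.1 x.2.2 s
  have hE : Eᴴ * E = 1 := by
    ext ℓ ℓ'
    calc (Eᴴ * E) ℓ ℓ'
        = (∑ i, star (u ℓ i) * u ℓ' i) * ((∑ j, star (v ℓ j) * v ℓ' j) *
            ∑ k, star (w ℓ k) * w ℓ' k) := by
          simp only [Matrix.mul_apply, conjTranspose_apply, E, Matrix.of_apply,
            Fintype.sum_prod_type, star_mul']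
          rw [Finset.sum_mul]
          refine Finset.sum_congr rfl fun i _ => ?_
          rw [Finset.sum_mul_sum, Finset.mul_sum]
          refine Finset.sum_congr rfl fun j _ => ?_
          rw [Finset.mul_sum]
          exact Finset.sum_congr rfl fun k _ => by ring
      _ = (1 : Matrix (Fin p) (Fin p) ℂ) ℓ ℓ' := by
          rw [hu, hv, hw, Matrix.one_apply]; split_ifs <;> simp
  have hZ : Z * Zᴴ = 1 := by
    ext ℓ ℓ'
    simp only [Matrix.mul_apply, conjTranspose_apply, Z, Matrix.of_apply, Matrix.one_apply]
    simpa only [mul_comm, eq_comm] using hz ℓ' ℓ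
  have hC : IsUnit C := by
    rw [Matrix.isUnit_iff_isUnit_det, Matrix.det_diagonal, isUnit_iff_ne_zero]
    exact Finset.prod_ne_zero_iff.2 fun ℓ _ => Complex.ofReal_ne_zero.2 (hc ℓ).ne'
  have happly (Y : Matrix (Fin p) (Fin r) ℂ) (i j k s) : (E * C * Y) (i, j, k) s =
      ∑ ℓ, (c ℓ : ℂ) * u ℓ i * v ℓ j * w ℓ k * Y ℓ s := by
    rw [Matrix.mul_apply]
    simp only [C, Matrix.mul_diagonal, E, Matrix.of_apply]
    exact Finset.sum_congr rfl fun ℓ _ => by ring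
  have hΦ : Φ * Φᴴ = (E * C * Z) * (E * C * Z)ᴴ := by
    have hΨ : E * C * Z = Matrix.of fun x s => ψ x.1 x.2.1 x.2.2 s := by
      ext ⟨i, j, k⟩ s
      rw [happly]
      exact (hdec i j k s).symm
    rw [hΨ]
    ext ⟨i, j, k⟩ ⟨l, m, n⟩
    exact h i j k l m n
  obtain ⟨Z', hZ', hΦZ'⟩ := exists_orthonormal_rows_factorization E C Z Φ hE hZ hC hΦ
  refine ⟨p, c, u, v, w, Z', hc, hu, hv, hw, fun ℓ ℓ' => ?_, fun i j k s => ?_⟩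
  · have hentry := congrFun (congrFun hZ' ℓ') ℓ
    simpa only [Matrix.mul_apply, conjTranspose_apply, Matrix.one_apply, mul_comm, eq_comm]
      using hentry
  · rw [← happly, ← hΦZ']; rfl

/-- Schmidt decomposability is an invariant of purification: any two
purifications (with the same purifying system) of a density matrix of a tripartite
system are either both Schmidt decomposable as 4-partite states or both not. -/
theorem purification_schmidt_decomposability_invariant
    (d₁ d₂ d₃ r : ℕ)
    (ρ : Matrix (Fin d₁ × Fin d₂ × Fin d₃) (Fin d₁ × Fin d₂ × Fin d₃) ℂ)
    (hρ : ρ.PosSemidef) (htr : ρ.trace = 1)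
    (ψ₁ ψ₂ : Fin d₁ → Fin d₂ → Fin d₃ → Fin r → ℂ)
    (hψ₁ : ∀ i j k l m n,
      ∑ s, ψ₁ i j k s * star (ψ₁ l m n s) = ρ (i, j, k) (l, m, n))
    (hψ₂ : ∀ i j k l m n,
      ∑ s, ψ₂ i j k s * star (ψ₂ l m n s) = ρ (i, j, k) (l, m, n)) :
    SchmidtDecomposable4 ψ₁ ↔ SchmidtDecomposable4 ψ₂ :=
  ⟨fun h => h.of_partialTrace_eq fun i j k l m n => (hψ₂ i j k l m n).trans (hψ₁ i j k l m n).symm,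
    fun h => h.of_partialTrace_eq fun i j k l m n => (hψ₁ i j k l m n).trans (hψ₂ i j k l m n).symm⟩
end
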